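/- If under a choice profile Ch contracts are observable substitutes for monotone preferences and the observable law of aggregate demand for monotone preferences holds, then Ch satisfies non-manipulability: for every college c, the deferred acceptance mechanism for Ch is strategy-proof on the domain of monotone strict preference profiles in which every student finds only contracts with college c acceptable. -/

import Mathlib

open scoped Classical

namespace MWC

variable {C S T : Type*} [DecidableEq C] [DecidableEq S] [DecidableEq T] [LinearOrder T]

/-! Contracts are triples `(college, student, term)`.  For `x : C × S × T`,
`x.1` is the college, `x.2.1` the student and `x.2.2` the contract term.
The linear order on `T` plays the role of `▷`: higher terms are better for students. -/

variable (X : Finset (C × S × T))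

/-- The contracts in `X` naming college `c` (the set `X_c`). -/
def Xc (c : C) : Finset (C × S × T) := X.filter fun x => x.1 = c

/-- A set of contracts containing at most one contract per student. -/
def IsAlloc (Y : Finset (C × S × T)) : Prop :=
  ∀ x ∈ Y, ∀ y ∈ Y, x.2.1 = y.2.1 → x = y

/-- `Ch` is a valid choice function for college `c`: from each subset of `X_c` it
chooses a subset with at most one contract per student, and it satisfies the
irrelevance of rejected contracts (IRC). -/
def IsChoice (c : C) (Ch : Finset (C × S × T) → Finset (C × S × T)) : Prop :=
  (∀ Y, Y ⊆ Xc X c → Ch Y ⊆ Y) ∧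
  (∀ Y, Y ⊆ Xc X c → IsAlloc (Ch Y)) ∧
  (∀ Y, Y ⊆ Xc X c → ∀ x ∈ Xc X c, x ∉ Y → x ∉ Ch (insert x Y) → Ch Y = Ch (insert x Y))

/-- The rejection function `R_c(Y) = Y \ Ch_c(Y)`. -/
def Rej (Ch : Finset (C × S × T) → Finset (C × S × T)) (Y : Finset (C × S × T)) :
    Finset (C × S × T) := Y \ Ch Y

/-- Contracts are substitutes under `Ch` (for college `c`). -/
def Substitutes (c : C) (Ch : Finset (C × S × T) → Finset (C × S × T)) : Prop :=
  ∀ Y, Y ⊆ Xc X c → ∀ x ∈ Xc X c, ∀ z ∈ Xc X c, x ∉ Y → z ∉ Y →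
    x ∈ Ch (insert z (insert x Y)) → x ∈ Ch (insert x Y)

/-- The law of aggregate demand for `Ch` (college `c`). -/
def LAD (c : C) (Ch : Finset (C × S × T) → Finset (C × S × T)) : Prop :=
  ∀ Z Y, Z ⊆ Y → Y ⊆ Xc X c → (Ch Z).card ≤ (Ch Y).card

/-- `Y^min`: the contracts of `Y` that give each involved student his
`▷`-worst contract among his contracts in `Y`. -/
def Ymin (Y : Finset (C × S × T)) : Finset (C × S × T) :=
  Y.filter fun y => ∀ y' ∈ Y, y'.2.1 = y.2.1 → ¬ y'.2.2 < y.2.2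

/-- `Ch` is monotone in contract terms: it always chooses from `Y^min`. -/
def MonotoneCh (c : C) (Ch : Finset (C × S × T) → Finset (C × S × T)) : Prop :=
  ∀ Y, Y ⊆ Xc X c → Ch Y ⊆ Ymin Y

/-- `us` represents a strict preference of student `s` over his contracts in `X`
together with the outside option (utility `0`), monotone in contract terms:
a higher contract term is always strictly better. -/
def IsPref (s : S) (us : C × S × T → ℤ) : Prop :=
  (∀ x ∈ X, x.2.1 = s → us x ≠ 0) ∧
  (∀ x ∈ X, ∀ y ∈ X, x.2.1 = s → y.2.1 = s → x ≠ y → us x ≠ us y) ∧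
  (∀ x ∈ X, ∀ y ∈ X, x.2.1 = s → y.2.1 = s → y.2.2 < x.2.2 → us y < us x)

/-- The utility student `s` derives from allocation `Y` (`0` = outside option). -/
def util (us : C × S × T → ℤ) (s : S) (Y : Finset (C × S × T)) : ℤ :=
  ∑ x ∈ Y.filter (fun x => x.2.1 = s), us x

/-- Individual rationality of allocation `Y` in the market `(Ch, u)`. -/
def IndivRat (Ch : C → Finset (C × S × T) → Finset (C × S × T))
    (u : S → C × S × T → ℤ) (Y : Finset (C × S × T)) : Prop :=
  (∀ c, Y.filter (fun x => x.1 = c) = Ch c (Y.filter fun x => x.1 = c)) ∧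
  ∀ y ∈ Y, 0 < u y.2.1 y

/-- College `c` together with allocation `Z` blocks allocation `Y`. -/
def Blocks (Ch : C → Finset (C × S × T) → Finset (C × S × T))
    (u : S → C × S × T → ℤ) (c : C) (Z Y : Finset (C × S × T)) : Prop :=
  Z ⊆ X ∧ IsAlloc Z ∧
  Z.filter (fun x => x.1 = c) ≠ Y.filter (fun x => x.1 = c) ∧
  Z.filter (fun x => x.1 = c) = Ch c ((Y ∪ Z).filter fun x => x.1 = c) ∧
  ∀ z ∈ Z.filter (fun x => x.1 = c), util (u z.2.1) z.2.1 Y ≤ u z.2.1 z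

/-- Stability of allocation `Y` in the market `(Ch, u)`. -/
def Stable (Ch : C → Finset (C × S × T) → Finset (C × S × T))
    (u : S → C × S × T → ℤ) (Y : Finset (C × S × T)) : Prop :=
  Y ⊆ X ∧ IsAlloc Y ∧ IndivRat Ch u Y ∧ ¬ ∃ c Z, Blocks X Ch u c Z Y

/-- The contracts proposed when `D` is the set of contracts rejected so far:
every student proposes his most preferred acceptable not-yet-rejected contract. -/
def proposals (u : S → C × S × T → ℤ) (D : Finset (C × S × T)) : Finset (C × S × T) :=
  (X \ D).filter fun x =>
    0 < u x.2.1 x ∧ ∀ y ∈ X \ D, y.2.1 = x.2.1 → u x.2.1 y ≤ u x.2.1 x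

/-- The contracts tentatively held by the colleges among the proposals `P`:
each college `c` keeps its choice from the contracts proposed to it. -/
def held (Ch : C → Finset (C × S × T) → Finset (C × S × T))
    (P : Finset (C × S × T)) : Finset (C × S × T) :=
  P.filter fun x => x ∈ Ch x.1 (P.filter fun y => y.1 = x.1)

/-- One round of the student-proposing deferred acceptance algorithm, acting on the
cumulative set of rejected contracts. -/
def step (Ch : C → Finset (C × S × T) → Finset (C × S × T))
    (u : S → C × S × T → ℤ) (D : Finset (C × S × T)) : Finset (C × S × T) :=
  D ∪ (proposals X u D \ held Ch (proposals X u D))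

/-- The outcome `DA(Ch, u)` of the student-proposing deferred acceptance algorithm
(the algorithm reaches a fixed point after at most `|X| + 1` rounds). -/
def DA (Ch : C → Finset (C × S × T) → Finset (C × S × T))
    (u : S → C × S × T → ℤ) : Finset (C × S × T) :=
  held Ch (proposals X u ((step X Ch u)^[X.card + 1] ∅))

/-- The cumulative set of contracts proposed up to round `t` of the deferred
acceptance algorithm. -/
def cumProposed (Ch : C → Finset (C × S × T) → Finset (C × S × T))
    (u : S → C × S × T → ℤ) (t : ℕ) : Finset (C × S × T) :=
  (Finset.range (t + 1)).biUnion fun r => proposals X u ((step X Ch u)^[r] ∅)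

/-- Two choice profiles are deferred-acceptance-equivalent if the DA algorithm
produces the same outcome under both, for every profile of strict preferences
monotone in contract terms. -/
def DAeq (Ch Ch' : C → Finset (C × S × T) → Finset (C × S × T)) : Prop :=
  ∀ u : S → C × S × T → ℤ, (∀ s, IsPref X s (u s)) → DA X Ch u = DA X Ch' u

/-- `Ch` is DA-stable: the DA outcome is stable for every profile of strict
preferences monotone in contract terms. -/
def DAStable (Ch : C → Finset (C × S × T) → Finset (C × S × T)) : Prop :=
  ∀ u : S → C × S × T → ℤ, (∀ s, IsPref X s (u s)) → Stable X Ch u (DA X Ch u)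

/-- Mechanism `M` is `Ch`-stable. -/
def StableMech (Ch : C → Finset (C × S × T) → Finset (C × S × T))
    (M : (S → C × S × T → ℤ) → Finset (C × S × T)) : Prop :=
  ∀ u : S → C × S × T → ℤ, (∀ s, IsPref X s (u s)) → Stable X Ch u (M u)

/-- Strategy-proofness of a mechanism on the domain of strict preferences
monotone in contract terms. -/
def SP (M : (S → C × S × T → ℤ) → Finset (C × S × T)) : Prop :=
  ∀ u u' : S → C × S × T → ℤ, (∀ s, IsPref X s (u s)) → (∀ s, IsPref X s (u' s)) →
    ∀ s : S, (∀ s', s' ≠ s → u' s' = u s') →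
      util (u s) s (M u') ≤ util (u s) s (M u)

/-- Group-strategy-proofness of a mechanism on the domain of strict preferences
monotone in contract terms. -/
def GSP (M : (S → C × S × T → ℤ) → Finset (C × S × T)) : Prop :=
  ∀ u u' : S → C × S × T → ℤ, (∀ s, IsPref X s (u s)) → (∀ s, IsPref X s (u' s)) →
    ∀ S' : Set S, S'.Nonempty → (∀ s, s ∉ S' → u' s = u s) →
      ∃ s' ∈ S', util (u s') s' (M u') ≤ util (u s') s' (M u)

/-- The sequence `L` consists of contracts in `X_c`. -/
def SeqIn (c : C) (L : List (C × S × T)) : Prop := ∀ x ∈ L, x ∈ Xc X c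

/-- The sequence `L` is generated from monotone preferences: every contract (of the
relevant college) with the same student and a strictly higher term than the `t`-th
element appears among the first `t` elements. -/
def GenMono (c : C) (L : List (C × S × T)) : Prop :=
  ∀ (t : ℕ) (ht : t < L.length), ∀ x ∈ Xc X c, x.2.1 = (L.get ⟨t, ht⟩).2.1 →
    (L.get ⟨t, ht⟩).2.2 < x.2.2 → x ∈ L.take t

/-- The sequence `L` is observable under `Ch`: the student of each next contract is
not among the students currently chosen by `Ch`. -/
def ObsSeq (Ch : Finset (C × S × T) → Finset (C × S × T)) (L : List (C × S × T)) : Prop :=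
  ∀ (t : ℕ) (ht : t < L.length), 0 < t →
    (L.get ⟨t, ht⟩).2.1 ∉ (Ch (L.take t).toFinset).image fun y => y.2.1

/-- Observable substitutability for monotone preferences. -/
def ObsSub (c : C) (Ch : Finset (C × S × T) → Finset (C × S × T)) : Prop :=
  ∀ L : List (C × S × T), SeqIn X c L → GenMono X c L → ObsSeq Ch L →
    ∀ t : ℕ, t + 1 ≤ L.length →
      Rej Ch (L.take t).toFinset ⊆ Rej Ch (L.take (t + 1)).toFinset

/-- The observable law of aggregate demand for monotone preferences. -/
def ObsLAD (c : C) (Ch : Finset (C × S × T) → Finset (C × S × T)) : Prop :=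
  ∀ L : List (C × S × T), SeqIn X c L → GenMono X c L → ObsSeq Ch L →
    ∀ t : ℕ, t + 1 ≤ L.length →
      (Ch (L.take t).toFinset).card ≤ (Ch (L.take (t + 1)).toFinset).card

/-- `Y` is an observable set under `Ch`. -/
def ObsSet (c : C) (Ch : Finset (C × S × T) → Finset (C × S × T))
    (Y : Finset (C × S × T)) : Prop :=
  ∃ L : List (C × S × T), L.Nodup ∧ L.toFinset = Y ∧ SeqIn X c L ∧
    GenMono X c L ∧ ObsSeq Ch L

/-- `Ytil` is a maximal observable subset of `Y` under `Ch`. -/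
def MaxObsSubset (c : C) (Ch : Finset (C × S × T) → Finset (C × S × T))
    (Y Ytil : Finset (C × S × T)) : Prop :=
  Ytil ⊆ Y ∧ ObsSet X c Ch Ytil ∧
    ∀ Y', ObsSet X c Ch Y' → Ytil ⊆ Y' → Y' ⊆ Y → Y' = Ytil

/-- `U(Y)`: the contracts in `X_c` that are at least as good for the involved
student as some contract of his in `Y`. -/
def Uset (c : C) (Y : Finset (C × S × T)) : Finset (C × S × T) :=
  (Xc X c).filter fun x => ∃ y ∈ Y, x.2.1 = y.2.1 ∧ (y.2.2 < x.2.2 ∨ x = y)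

/-- `Y^∨`: the (under observable substitutability unique) maximal observable subset
of `U(Y)` under `Ch`. -/
noncomputable def vee (c : C) (Ch : Finset (C × S × T) → Finset (C × S × T))
    (Y : Finset (C × S × T)) : Finset (C × S × T) :=
  if h : ∃ V, MaxObsSubset X c Ch (Uset X c Y) V then h.choose else ∅

/-- The virtual choice function
`Ch'_c(Y) = { x ∈ Y^min : x_S ∈ [Ch_c(Y^∨)]_S }`. -/
noncomputable def virtualChoice (c : C) (Ch : Finset (C × S × T) → Finset (C × S × T))
    (Y : Finset (C × S × T)) : Finset (C × S × T) :=
  (Ymin Y).filter fun x => x.2.1 ∈ (Ch (vee X c Ch Y)).image fun y => y.2.1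

/-- Under `u` every student finds only contracts with college `c` acceptable. -/
def OnlyCollege (X : Finset (C × S × T)) (c : C) (u : S → C × S × T → ℤ) : Prop :=
  ∀ s : S, ∀ x ∈ X, x.2.1 = s → 0 < u s x → x.1 = c

/-! ### Auxiliary notions: observable growth of offer sets -/

/-- Contract `x` can be offered next, given that the set `Y` has been offered so far. -/
def NextOffer (X : Finset (C × S × T)) (c : C) (Ch : Finset (C × S × T) → Finset (C × S × T))
    (Y : Finset (C × S × T)) (x : C × S × T) : Prop :=
  x ∈ Xc X c ∧ x ∉ Y ∧ (∀ y ∈ Xc X c, y.2.1 = x.2.1 → x.2.2 < y.2.2 → y ∈ Y) ∧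
    ∀ z ∈ Ch Y, z.2.1 ≠ x.2.1

/-- One observable offer. -/
def Grow (X : Finset (C × S × T)) (c : C) (Ch : Finset (C × S × T) → Finset (C × S × T))
    (Y W : Finset (C × S × T)) : Prop :=
  ∃ x, NextOffer X c Ch Y x ∧ W = insert x Y

/-- Sets reachable from the empty set by observable offers. -/
def Reach (X : Finset (C × S × T)) (c : C) (Ch : Finset (C × S × T) → Finset (C × S × T))
    (Y : Finset (C × S × T)) : Prop :=
  Relation.ReflTransGen (Grow X c Ch) ∅ Y

theorem Reach.grow {X : Finset (C × S × T)} {c : C}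
    {Ch : Finset (C × S × T) → Finset (C × S × T)} {Y : Finset (C × S × T)} {x : C × S × T}
    (h : Reach X c Ch Y) (hx : NextOffer X c Ch Y x) : Reach X c Ch (insert x Y) :=
  Relation.ReflTransGen.tail h ⟨x, hx, rfl⟩

theorem Reach.subset {X : Finset (C × S × T)} {c : C}
    {Ch : Finset (C × S × T) → Finset (C × S × T)} {Y : Finset (C × S × T)}
    (h : Reach X c Ch Y) : Y ⊆ Xc X c := by
  induction h with
  | refl => simp
  | tail _ hs ih =>
    obtain ⟨x, hx, rfl⟩ := hs
    exact Finset.insert_subset hx.1 ih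

theorem Reach.upper {X : Finset (C × S × T)} {c : C}
    {Ch : Finset (C × S × T) → Finset (C × S × T)} {Y : Finset (C × S × T)}
    (h : Reach X c Ch Y) : ∀ z ∈ Y, ∀ y ∈ Xc X c, y.2.1 = z.2.1 → z.2.2 < y.2.2 → y ∈ Y := by
  induction h with
  | refl => simp
  | tail _ hs ih =>
    obtain ⟨x, hx, rfl⟩ := hs
    intro z hz y hy h1 h2
    rcases Finset.mem_insert.1 hz with rfl | hz
    · exact Finset.mem_insert_of_mem (hx.2.2.1 y hy h1 h2)
    · exact Finset.mem_insert_of_mem (ih z hz y hy h1 h2)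

/-- Extending an observable sequence by a next offer. -/
theorem seq_append {X : Finset (C × S × T)} {c : C}
    {Ch : Finset (C × S × T) → Finset (C × S × T)} {L : List (C × S × T)} {x : C × S × T}
    (h1 : SeqIn X c L) (h2 : GenMono X c L) (h3 : ObsSeq Ch L)
    (hx : NextOffer X c Ch L.toFinset x) :
    SeqIn X c (L ++ [x]) ∧ GenMono X c (L ++ [x]) ∧ ObsSeq Ch (L ++ [x]) := by
  refine ⟨?_, ?_, ?_⟩
  · intro y hy
    rcases List.mem_append.1 hy with hy | hy
    · exact h1 y hy
    · rw [List.mem_singleton] at hy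
      exact hy ▸ hx.1
  · intro t ht y hy e1 e2
    rcases Nat.lt_or_ge t L.length with hl | hl
    · have e : (L ++ [x]).get ⟨t, ht⟩ = L.get ⟨t, hl⟩ := by
        simp [List.getElem_append_left hl]
      rw [e] at e1 e2
      rw [List.take_append_of_le_length hl.le]
      exact h2 t hl y hy e1 e2
    · have ht' : t = L.length := by
        simp at ht
        omega
      subst ht'
      have e : (L ++ [x]).get ⟨L.length, ht⟩ = x := by simp
      rw [e] at e1 e2
      simpa using hx.2.2.1 y hy e1 e2
  · intro t ht h0
    rcases Nat.lt_or_ge t L.length with hl | hl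
    · have e : (L ++ [x]).get ⟨t, ht⟩ = L.get ⟨t, hl⟩ := by
        simp [List.getElem_append_left hl]
      rw [e, List.take_append_of_le_length hl.le]
      exact h3 t hl h0
    · have ht' : t = L.length := by
        simp at ht
        omega
      subst ht'
      have e : (L ++ [x]).get ⟨L.length, ht⟩ = x := by simp
      have e' : (L ++ [x]).take L.length = L := by simp
      rw [e, e']
      intro hm
      obtain ⟨z, hz, hzx⟩ := Finset.mem_image.1 hm
      exact hx.2.2.2 z hz hzx

theorem Reach.seq {X : Finset (C × S × T)} {c : C}
    {Ch : Finset (C × S × T) → Finset (C × S × T)} {Y : Finset (C × S × T)}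
    (h : Reach X c Ch Y) :
    ∃ L : List (C × S × T), L.toFinset = Y ∧ SeqIn X c L ∧ GenMono X c L ∧ ObsSeq Ch L := by
  induction h with
  | refl =>
    refine ⟨[], by simp, ?_, ?_, ?_⟩
    · intro x hx
      simp at hx
    · intro t ht
      simp at ht
    · intro t ht
      simp at ht
  | tail _ hs ih =>
    obtain ⟨x, hx, rfl⟩ := hs
    obtain ⟨L, rfl, h1, h2, h3⟩ := ih
    refine ⟨L ++ [x], ?_, seq_append h1 h2 h3 hx⟩
    ext y
    simp [or_comm]

theorem Reach.rej {X : Finset (C × S × T)} {c : C}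
    {Ch : Finset (C × S × T) → Finset (C × S × T)} {Y : Finset (C × S × T)} {x : C × S × T}
    (hobs : ObsSub X c Ch) (h : Reach X c Ch Y) (hx : NextOffer X c Ch Y x) :
    ∀ y ∈ Y, y ∉ Ch Y → y ∉ Ch (insert x Y) := by
  obtain ⟨L, rfl, h1, h2, h3⟩ := h.seq
  obtain ⟨k1, k2, k3⟩ := seq_append h1 h2 h3 hx
  have key := hobs (L ++ [x]) k1 k2 k3 L.length (by simp)
  have e1 : (L ++ [x]).take L.length = L := by simp
  have e2 : ((L ++ [x]).take (L.length + 1)).toFinset = insert x L.toFinset := by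
    rw [List.take_of_length_le (by simp)]
    ext y
    simp [or_comm]
  rw [e1, e2] at key
  intro y hy hn
  have := key (show y ∈ Rej Ch L.toFinset from Finset.mem_sdiff.2 ⟨hy, hn⟩)
  exact (Finset.mem_sdiff.1 this).2

theorem NextOffer.unique {X : Finset (C × S × T)} {c : C}
    {Ch : Finset (C × S × T) → Finset (C × S × T)} {Y : Finset (C × S × T)} {x y : C × S × T}
    (hx : NextOffer X c Ch Y x) (hy : NextOffer X c Ch Y y) (e : x.2.1 = y.2.1) : x = y := by
  have cx := (Finset.mem_filter.1 hx.1).2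
  have cy := (Finset.mem_filter.1 hy.1).2
  rcases lt_trichotomy x.2.2 y.2.2 with h | h | h
  · exact absurd (hx.2.2.1 y hy.1 e.symm h) hy.2.1
  · exact Prod.ext (cx.trans cy.symm) (Prod.ext e h)
  · exact absurd (hy.2.2.1 x hx.1 e h) hx.2.1

theorem NextOffer.persist {X : Finset (C × S × T)} {c : C}
    {Ch : Finset (C × S × T) → Finset (C × S × T)} {Y : Finset (C × S × T)} {x y : C × S × T}
    (hCh : IsChoice X c Ch) (hobs : ObsSub X c Ch) (hY : Reach X c Ch Y)
    (hx : NextOffer X c Ch Y x) (hy : NextOffer X c Ch Y y) (hne : x ≠ y) :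
    NextOffer X c Ch (insert x Y) y := by
  refine ⟨hy.1, ?_, ?_, ?_⟩
  · intro h
    rcases Finset.mem_insert.1 h with h | h
    · exact hne h.symm
    · exact hy.2.1 h
  · intro z hz h1 h2
    exact Finset.mem_insert_of_mem (hy.2.2.1 z hz h1 h2)
  · intro z hz e
    rcases Finset.mem_insert.1 (hCh.1 _ (hY.grow hx).subset hz) with rfl | hzY
    · exact hne (hx.unique hy e)
    · exact hY.rej hobs hx z hzY (fun h => hy.2.2.2 z h e) hz

theorem reach_confl {X : Finset (C × S × T)} {c : C}
    {Ch : Finset (C × S × T) → Finset (C × S × T)} {A N : Finset (C × S × T)}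
    (hCh : IsChoice X c Ch) (hobs : ObsSub X c Ch)
    (hN : ∀ x ∈ A, ¬ NextOffer X c Ch N x) {Z : Finset (C × S × T)}
    (hp : Relation.ReflTransGen (Grow X c Ch) Z N) :
    Reach X c Ch Z → ∀ x ∈ A, NextOffer X c Ch Z x →
      Relation.ReflTransGen (Grow X c Ch) (insert x Z) N := by
  induction hp using Relation.ReflTransGen.head_induction_on with
  | refl =>
    intro _ x hx hn
    exact absurd hn (hN x hx)
  | head hs hr ih =>
    intro hZ x hx hn
    obtain ⟨y, hy, rfl⟩ := hs
    by_cases e : x = y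
    · rw [e]
      exact hr
    · have h1 := ih (hZ.grow hy) x hx (hy.persist hCh hobs hZ hn (Ne.symm e))
      refine Relation.ReflTransGen.head ⟨y, hn.persist hCh hobs hZ hy e, rfl⟩ ?_
      rw [Finset.insert_comm]
      exact h1

theorem reach_le {X : Finset (C × S × T)} {c : C}
    {Ch : Finset (C × S × T) → Finset (C × S × T)} {A N : Finset (C × S × T)}
    (hCh : IsChoice X c Ch) (hobs : ObsSub X c Ch) (hNr : Reach X c Ch N)
    (hN : ∀ x ∈ A, ¬ NextOffer X c Ch N x) {Y : Finset (C × S × T)}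
    (hY : Reach X c Ch Y) :
    Y ⊆ A → Relation.ReflTransGen (Grow X c Ch) Y N := by
  induction hY with
  | refl => exact fun _ => hNr
  | tail hr hs ih =>
    intro hA
    obtain ⟨x, hx, rfl⟩ := hs
    exact reach_confl hCh hobs hN (ih ((Finset.subset_insert _ _).trans hA)) hr x
      (hA (Finset.mem_insert_self _ _)) hx

theorem grow_subset {X : Finset (C × S × T)} {c : C}
    {Ch : Finset (C × S × T) → Finset (C × S × T)} {Y N : Finset (C × S × T)}
    (h : Relation.ReflTransGen (Grow X c Ch) Y N) : Y ⊆ N := by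
  induction h with
  | refl => exact subset_rfl
  | tail _ hs ih =>
    obtain ⟨x, _, rfl⟩ := hs
    exact ih.trans (Finset.subset_insert _ _)

theorem normal_unique {X : Finset (C × S × T)} {c : C}
    {Ch : Finset (C × S × T) → Finset (C × S × T)} {A N N' : Finset (C × S × T)}
    (hCh : IsChoice X c Ch) (hobs : ObsSub X c Ch)
    (h1 : Reach X c Ch N) (hA : N ⊆ A) (hN : ∀ x ∈ A, ¬ NextOffer X c Ch N x)
    (h1' : Reach X c Ch N') (hA' : N' ⊆ A) (hN' : ∀ x ∈ A, ¬ NextOffer X c Ch N' x) :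
    N = N' :=
  (grow_subset (reach_le hCh hobs h1' hN' h1 hA)).antisymm
    (grow_subset (reach_le hCh hobs h1 hN h1' hA'))

/-- A chosen contract is the worst one offered so far by its student. -/
theorem Reach.worst {X : Finset (C × S × T)} {c : C}
    {Ch : Finset (C × S × T) → Finset (C × S × T)} {Y : Finset (C × S × T)}
    (hCh : IsChoice X c Ch) (hobs : ObsSub X c Ch) (h : Reach X c Ch Y) :
    ∀ x ∈ Ch Y, ∀ z ∈ Y, z.2.1 = x.2.1 → x.2.2 ≤ z.2.2 := by
  induction h with
  | refl => simp
  | @tail b _ hr hs ih =>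
    obtain ⟨w, hw, rfl⟩ := hs
    have hr' : Reach X c Ch _ := hr
    intro x hx z hz e
    rcases Finset.mem_insert.1 (hCh.1 _ (hr'.grow hw).subset hx) with rfl | hxY
    · rcases Finset.mem_insert.1 hz with rfl | hz
      · exact le_rfl
      · by_contra hlt
        exact hw.2.1 (hr'.upper z hz x hw.1 e.symm (not_le.1 hlt))
    · by_cases hc : x ∈ Ch b
      · rcases Finset.mem_insert.1 hz with rfl | hz
        · exact absurd e.symm (hw.2.2.2 x hc)
        · exact ih x hc z hz e
      · exact absurd hx (hr'.rej hobs hw x hxY hc)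

/-- Adding a batch of simultaneous offers. -/
theorem Reach.batch {X : Finset (C × S × T)} {c : C}
    {Ch : Finset (C × S × T) → Finset (C × S × T)} {Y : Finset (C × S × T)}
    (hCh : IsChoice X c Ch) (hobs : ObsSub X c Ch) (Q : Finset (C × S × T)) :
    Reach X c Ch Y → (∀ x ∈ Q, NextOffer X c Ch Y x) →
      Reach X c Ch (Y ∪ Q) ∧ ∀ y ∈ Y, y ∉ Ch Y → y ∉ Ch (Y ∪ Q) := by
  induction Q using Finset.induction_on generalizing Y with
  | empty =>
    intro h _
    simpa using h
  | insert q Q hq ih =>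
    intro h hQ
    have hqn := hQ q (Finset.mem_insert_self _ _)
    have e : Y ∪ insert q Q = insert q Y ∪ Q := by
      ext y
      simp only [Finset.mem_union, Finset.mem_insert]
      tauto
    rw [e]
    obtain ⟨h1, h2⟩ := ih (h.grow hqn) (fun x hx =>
      hqn.persist hCh hobs h (hQ x (Finset.mem_insert_of_mem hx)) (fun e => hq (e ▸ hx)))
    refine ⟨h1, fun y hy hn => h2 y (Finset.mem_insert_of_mem hy) ?_⟩
    exact h.rej hobs hqn y hy hn

theorem irc_union {X : Finset (C × S × T)} {c : C}
    {Ch : Finset (C × S × T) → Finset (C × S × T)}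
    (hCh : IsChoice X c Ch) (P : Finset (C × S × T)) (E : Finset (C × S × T)) :
    Disjoint P E → P ∪ E ⊆ Xc X c → Ch (P ∪ E) ⊆ P → Ch P = Ch (P ∪ E) := by
  induction E using Finset.induction_on with
  | empty => simp
  | insert e E he ih =>
    intro hd hs hc
    rw [Finset.disjoint_insert_right] at hd
    rw [Finset.union_insert] at hs hc ⊢
    have hne : e ∉ P ∪ E := by
      simp [hd.1, he]
    have key := hCh.2.2 (P ∪ E) ((Finset.subset_insert _ _).trans hs) e
      (hs (Finset.mem_insert_self _ _)) hne (fun h => hd.1 (hc h))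
    rw [← key] at hc ⊢
    exact ih hd.2 ((Finset.subset_insert _ _).trans hs) hc

/-- The contracts acceptable under `u`. -/
def Acc (X : Finset (C × S × T)) (u : S → C × S × T → ℤ) : Finset (C × S × T) :=
  X.filter fun x => 0 < u x.2.1 x

theorem acc_subset {X : Finset (C × S × T)} {c : C} {u : S → C × S × T → ℤ}
    (hO : OnlyCollege X c u) : Acc X u ⊆ Xc X c := by
  intro x hx
  obtain ⟨h1, h2⟩ := Finset.mem_filter.1 hx
  exact Finset.mem_filter.2 ⟨h1, hO _ x h1 rfl h2⟩

theorem mem_proposals {X : Finset (C × S × T)} {u : S → C × S × T → ℤ}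
    {D : Finset (C × S × T)} {x : C × S × T} :
    x ∈ proposals X u D ↔ (x ∈ X ∧ x ∉ D) ∧ 0 < u x.2.1 x ∧
      ∀ y ∈ X \ D, y.2.1 = x.2.1 → u x.2.1 y ≤ u x.2.1 x := by
  simp only [proposals, Finset.mem_filter, Finset.mem_sdiff]

theorem proposals_acc {X : Finset (C × S × T)} {u : S → C × S × T → ℤ}
    {D : Finset (C × S × T)} : proposals X u D ⊆ Acc X u := by
  intro x hx
  rw [mem_proposals] at hx
  exact Finset.mem_filter.2 ⟨hx.1.1, hx.2.1⟩

theorem held_eq {X : Finset (C × S × T)} {c : C}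
    {Ch : C → Finset (C × S × T) → Finset (C × S × T)} (hCh : IsChoice X c (Ch c))
    {P : Finset (C × S × T)} (hP : P ⊆ Xc X c) : held Ch P = Ch c P := by
  have hc : ∀ x ∈ P, x.1 = c := fun x hx => (Finset.mem_filter.1 (hP hx)).2
  have hf : P.filter (fun y => y.1 = c) = P := Finset.filter_true_of_mem hc
  ext x
  unfold held
  rw [Finset.mem_filter]
  constructor
  · rintro ⟨h1, h2⟩
    rw [hc x h1, hf] at h2
    exact h2
  · intro h
    have h1 := hCh.1 P hP h
    refine ⟨h1, ?_⟩
    rw [hc x h1, hf]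
    exact h

/-- The invariant of the deferred acceptance algorithm. -/
def DAInv (X : Finset (C × S × T)) (c : C) (Ch : C → Finset (C × S × T) → Finset (C × S × T))
    (u : S → C × S × T → ℤ) (D : Finset (C × S × T)) : Prop :=
  D ⊆ Acc X u ∧ Reach X c (Ch c) (D ∪ proposals X u D) ∧
    ∀ x ∈ D, x ∉ Ch c (D ∪ proposals X u D)

theorem inv_held {X : Finset (C × S × T)} {c : C}
    {Ch : C → Finset (C × S × T) → Finset (C × S × T)} (hCh : IsChoice X c (Ch c))
    {u : S → C × S × T → ℤ} {D : Finset (C × S × T)} (hI : DAInv X c Ch u D) :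
    held Ch (proposals X u D) = Ch c (D ∪ proposals X u D) := by
  obtain ⟨_, h2, h3⟩ := hI
  have hs := h2.subset
  rw [held_eq hCh (Finset.subset_union_right.trans hs)]
  rw [Finset.union_comm] at hs h3 ⊢
  refine irc_union hCh _ _ ?_ hs ?_
  · rw [Finset.disjoint_left]
    intro x hx hD
    exact (mem_proposals.1 hx).1.2 hD
  · intro x hx
    rcases Finset.mem_union.1 (hCh.1 _ hs hx) with h | h
    · exact h
    · exact absurd hx (h3 x h)

/-- Abstract one-round lemma: `Y` is the set offered so far, `D` its rejected part. -/
theorem proposal_next {X : Finset (C × S × T)} {c : C} {Ch : Finset (C × S × T) → Finset (C × S × T)}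
    {u : S → C × S × T → ℤ} (hu : ∀ s, IsPref X s (u s)) (hO : OnlyCollege X c u)
    {D Y : Finset (C × S × T)} (hDY : D ⊆ Y)
    (hheld : ∀ z ∈ Ch Y, z ∈ X ∧ z ∉ D ∧ ∀ y ∈ X, y ∉ Y → y.2.1 = z.2.1 → u z.2.1 y ≤ u z.2.1 z)
    (hsub : Ch Y ⊆ Y) :
    ∀ x ∈ proposals X u D, x ∉ Y → NextOffer X c Ch Y x := by
  intro x hx hxY
  have hA := acc_subset hO (proposals_acc hx)
  rw [mem_proposals] at hx
  obtain ⟨⟨hxX, hxD⟩, hpos, hmax⟩ := hx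
  refine ⟨hA, hxY, ?_, ?_⟩
  · intro y hy e hlt
    by_contra hyY
    have hyX := (Finset.mem_filter.1 hy).1
    have h1 := hmax y (Finset.mem_sdiff.2 ⟨hyX, fun h => hyY (hDY h)⟩) e
    have h2 := (hu x.2.1).2.2 y hyX x hxX e rfl hlt
    omega
  · intro z hz e
    obtain ⟨hzX, hzD, hzm⟩ := hheld z hz
    have h1 := hmax z (Finset.mem_sdiff.2 ⟨hzX, hzD⟩) e
    have h2 := hzm x hxX hxY e.symm
    rw [e] at h2
    have hne : z ≠ x := fun h => hxY (h ▸ hsub hz)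
    exact (hu x.2.1).2.1 z hzX x hxX e rfl hne (le_antisymm h1 h2)

theorem inv_init {X : Finset (C × S × T)} {c : C}
    {Ch : C → Finset (C × S × T) → Finset (C × S × T)} (hCh : IsChoice X c (Ch c))
    (hobs : ObsSub X c (Ch c)) {u : S → C × S × T → ℤ} (hu : ∀ s, IsPref X s (u s))
    (hO : OnlyCollege X c u) : DAInv X c Ch u ∅ := by
  have hs : Ch c ∅ ⊆ ∅ := hCh.1 ∅ (by simp)
  refine ⟨by simp, ?_, by simp⟩
  refine (Reach.batch hCh hobs _ Relation.ReflTransGen.refl ?_).1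
  intro x hx
  refine proposal_next hu hO subset_rfl ?_ hs x hx (by simp)
  intro z hz
  exact absurd (hs hz) (by simp)

theorem inv_step {X : Finset (C × S × T)} {c : C}
    {Ch : C → Finset (C × S × T) → Finset (C × S × T)} (hCh : IsChoice X c (Ch c))
    (hobs : ObsSub X c (Ch c)) {u : S → C × S × T → ℤ} (hu : ∀ s, IsPref X s (u s))
    (hO : OnlyCollege X c u) {D : Finset (C × S × T)} (hI : DAInv X c Ch u D) :
    DAInv X c Ch u (step X Ch u D) := by
  have hh := inv_held hCh hI
  obtain ⟨h1, h2, h3⟩ := hI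
  have hstep : step X Ch u D = D ∪ (proposals X u D \ held Ch (proposals X u D)) := rfl
  rw [hh] at hstep
  generalize hD' : step X Ch u D = D' at hstep ⊢
  set Y := D ∪ proposals X u D with hY
  have hsub : Ch c Y ⊆ Y := hCh.1 _ h2.subset
  have hmem : ∀ x, x ∈ D' ↔ x ∈ Y ∧ x ∉ Ch c Y := by
    intro x
    rw [hstep, hY, Finset.mem_union, Finset.mem_sdiff, Finset.mem_union, ← hY]
    have := h3 x
    tauto
  have hDD' : D ⊆ D' := by
    rw [hstep]
    exact Finset.subset_union_left
  have hP : ∀ z ∈ Ch c Y, z ∈ proposals X u D := by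
    intro z hz
    rcases Finset.mem_union.1 (hsub hz) with h | h
    · exact absurd hz (h3 z h)
    · exact h
  have hnext : ∀ x ∈ proposals X u D' \ Y, NextOffer X c (Ch c) Y x := by
    intro x hx
    rw [Finset.mem_sdiff] at hx
    refine proposal_next hu hO (fun y hy => ((hmem y).1 hy).1) ?_ hsub x hx.1 hx.2
    intro z hz
    have hz' := mem_proposals.1 (hP z hz)
    refine ⟨hz'.1.1, fun h => ((hmem z).1 h).2 hz, ?_⟩
    intro y hy hyY e
    exact hz'.2.2 y (Finset.mem_sdiff.2 ⟨hy, fun h => hyY (Finset.mem_union_left _ h)⟩) e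
  have hEq : D' ∪ proposals X u D' = Y ∪ (proposals X u D' \ Y) := by
    ext x
    simp only [Finset.mem_union, Finset.mem_sdiff]
    constructor
    · rintro (h | h)
      · exact Or.inl ((hmem x).1 h).1
      · by_cases hx : x ∈ Y
        · exact Or.inl hx
        · exact Or.inr ⟨h, hx⟩
    · rintro (h | h)
      · by_cases hx : x ∈ Ch c Y
        · right
          have hz' := mem_proposals.1 (hP x hx)
          refine mem_proposals.2 ⟨⟨hz'.1.1, fun h => ((hmem x).1 h).2 hx⟩, hz'.2.1, ?_⟩
          intro y hy e
          rw [Finset.mem_sdiff] at hy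
          exact hz'.2.2 y (Finset.mem_sdiff.2 ⟨hy.1, fun h => hy.2 (hDD' h)⟩) e
        · exact Or.inl ((hmem x).2 ⟨h, hx⟩)
      · exact Or.inr h.1
  obtain ⟨k1, k2⟩ := Reach.batch hCh hobs _ h2 hnext
  refine ⟨?_, ?_, ?_⟩
  · intro x hx
    rcases Finset.mem_union.1 ((hmem x).1 hx).1 with h | h
    · exact h1 h
    · exact proposals_acc h
  · rw [hEq]
    exact k1
  · intro x hx
    rw [hEq]
    exact k2 x ((hmem x).1 hx).1 ((hmem x).1 hx).2

/-- An inflationary self-map of the subsets of `X` stabilises. -/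
theorem iterate_fixed {α : Type*} (X : Finset α) (f : Finset α → Finset α)
    (hinc : ∀ D, D ⊆ f D) (hb : ∀ n, f^[n] ∅ ⊆ X) :
    f (f^[X.card + 1] ∅) = f^[X.card + 1] ∅ := by
  by_contra hne
  have hall : ∀ n, n ≤ X.card + 1 → f (f^[n] ∅) ≠ f^[n] ∅ := by
    intro n hn hfix
    apply hne
    have hk : ∀ k, f^[n + k] ∅ = f^[n] ∅ := by
      intro k
      induction k with
      | zero => rfl
      | succ k ih => rw [← Nat.add_assoc, Function.iterate_succ_apply', ih, hfix]
    obtain ⟨k, hk'⟩ := Nat.exists_eq_add_of_le hn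
    rw [hk', hk k, hfix]
  have hcard : ∀ n, n ≤ X.card + 1 → n ≤ (f^[n] ∅).card := by
    intro n
    induction n with
    | zero => simp
    | succ n ih =>
      intro hn
      have h1 := ih (by omega)
      rw [Function.iterate_succ_apply']
      have h2 := Finset.card_lt_card
        ((hinc (f^[n] ∅)).ssubset_of_ne (Ne.symm (hall n (by omega))))
      omega
  have h1 := hcard _ le_rfl
  have h2 := Finset.card_le_card (hb (X.card + 1))
  omega

theorem DA_spec {X : Finset (C × S × T)} {c : C}
    {Ch : C → Finset (C × S × T) → Finset (C × S × T)} (hCh : IsChoice X c (Ch c))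
    (hobs : ObsSub X c (Ch c)) {u : S → C × S × T → ℤ} (hu : ∀ s, IsPref X s (u s))
    (hO : OnlyCollege X c u) :
    ∃ N, Reach X c (Ch c) N ∧ N ⊆ Acc X u ∧ (∀ x ∈ Acc X u, ¬ NextOffer X c (Ch c) N x) ∧
      DA X Ch u = Ch c N := by
  have hinv : ∀ n, DAInv X c Ch u ((step X Ch u)^[n] ∅) := by
    intro n
    induction n with
    | zero => exact inv_init hCh hobs hu hO
    | succ n ih =>
      rw [Function.iterate_succ_apply']
      exact inv_step hCh hobs hu hO ih
  have hfix := iterate_fixed X (step X Ch u) (fun D => Finset.subset_union_left)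
    (fun n => (hinv n).1.trans (Finset.filter_subset _ _))
  have hI := hinv (X.card + 1)
  unfold DA
  generalize (step X Ch u)^[X.card + 1] ∅ = D at hfix hI ⊢
  have hh := inv_held hCh hI
  refine ⟨D ∪ proposals X u D, hI.2.1, Finset.union_subset hI.1 proposals_acc, ?_, hh⟩
  intro x hx hn
  obtain ⟨hxX, hpos⟩ := Finset.mem_filter.1 hx
  have hxD : x ∉ D := fun h => hn.2.1 (Finset.mem_union_left _ h)
  obtain ⟨z, hz, hzm⟩ := Finset.exists_max_image
    ((X \ D).filter fun y => y.2.1 = x.2.1) (u x.2.1)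
    ⟨x, Finset.mem_filter.2 ⟨Finset.mem_sdiff.2 ⟨hxX, hxD⟩, rfl⟩⟩
  obtain ⟨hz1, hz2⟩ := Finset.mem_filter.1 hz
  have hzx := hzm x (Finset.mem_filter.2 ⟨Finset.mem_sdiff.2 ⟨hxX, hxD⟩, rfl⟩)
  have hzP : z ∈ proposals X u D := by
    refine mem_proposals.2 ⟨Finset.mem_sdiff.1 hz1, ?_, ?_⟩
    · rw [hz2]
      omega
    · intro y hy e
      rw [hz2] at e ⊢
      exact hzm y (Finset.mem_filter.2 ⟨hy, e⟩)
  have hzC : z ∈ held Ch (proposals X u D) := by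
    by_contra hc
    have : z ∈ step X Ch u D := Finset.mem_union_right _ (Finset.mem_sdiff.2 ⟨hzP, hc⟩)
    rw [hfix] at this
    exact (Finset.mem_sdiff.1 hz1).2 this
  rw [hh] at hzC
  exact hn.2.2.2 z hzC hz2

/-- observable substitutability and the observable law of aggregate
demand imply non-manipulability: for every college `c` the deferred acceptance
mechanism is strategy-proof on the domain of monotone strict preference profiles
in which only contracts with `c` are acceptable. -/
theorem statement_17 [Fintype C] [Fintype S] [Fintype T]
    (X : Finset (C × S × T)) (Ch : C → Finset (C × S × T) → Finset (C × S × T))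
    (hCh : ∀ c, IsChoice X c (Ch c))
    (hobs : ∀ c, ObsSub X c (Ch c))
    (hlad : ∀ c, ObsLAD X c (Ch c)) :
    ∀ c : C, ∀ u u' : S → C × S × T → ℤ,
      (∀ s, IsPref X s (u s)) → (∀ s, IsPref X s (u' s)) →
      OnlyCollege X c u → OnlyCollege X c u' →
      ∀ s : S, (∀ s', s' ≠ s → u' s' = u s') →
        util (u s) s (DA X Ch u') ≤ util (u s) s (DA X Ch u) := by
  intro c u u' hu hu' hO hO' s hs
  obtain ⟨N, hN1, hN2, hN3, hN4⟩ := DA_spec (hCh c) (hobs c) hu hO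
  obtain ⟨N', hN1', hN2', hN3', hN4'⟩ := DA_spec (hCh c) (hobs c) hu' hO'
  by_cases hx : ∃ x ∈ Ch c N', x.2.1 = s ∧ 0 < u s x
  · obtain ⟨x, hxC, hxs, hxpos⟩ := hx
    have hsub' : N' ⊆ X := hN2'.trans (Finset.filter_subset _ _)
    have hxN : x ∈ N' := (hCh c).1 _ hN1'.subset hxC
    have hA : N' ⊆ Acc X u := by
      intro z hz
      refine Finset.mem_filter.2 ⟨hsub' hz, ?_⟩
      by_cases hzs : z.2.1 = s
      · rw [hzs]
        rcases (hN1'.worst (hCh c) (hobs c) x hxC z hz (hzs.trans hxs.symm)).lt_or_eq with h | h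
        · exact hxpos.trans ((hu s).2.2 z (hsub' hz) x (hsub' hxN) hzs hxs h)
        · have c1 := (Finset.mem_filter.1 (hN1'.subset hz)).2
          have c2 := (Finset.mem_filter.1 (hN1'.subset hxN)).2
          have e : z = x := Prod.ext (c1.trans c2.symm) (Prod.ext (hzs.trans hxs.symm) h.symm)
          rw [e]
          exact hxpos
      · rw [← hs _ hzs]
        exact (Finset.mem_filter.1 (hN2' hz)).2
    have hmax : ∀ z ∈ Acc X u, ¬ NextOffer X c (Ch c) N' z := by
      intro z hz hn
      by_cases hzs : z.2.1 = s
      · exact hn.2.2.2 x hxC (hxs.trans hzs.symm)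
      · refine hN3' z ?_ hn
        obtain ⟨h1, h2⟩ := Finset.mem_filter.1 hz
        refine Finset.mem_filter.2 ⟨h1, ?_⟩
        rw [hs _ hzs]
        exact h2
    have e := normal_unique (hCh c) (hobs c) hN1 hN2 hN3 hN1' hA hmax
    rw [hN4, hN4', e]
  · have h1 : util (u s) s (DA X Ch u') ≤ 0 := by
      rw [hN4']
      apply Finset.sum_nonpos
      intro x hxm
      obtain ⟨h1, h2⟩ := Finset.mem_filter.1 hxm
      by_contra hlt
      exact hx ⟨x, h1, h2, not_le.1 hlt⟩
    have h2 : 0 ≤ util (u s) s (DA X Ch u) := by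
      rw [hN4]
      apply Finset.sum_nonneg
      intro x hxm
      obtain ⟨h1, h2⟩ := Finset.mem_filter.1 hxm
      have := (Finset.mem_filter.1 (hN2 ((hCh c).1 _ hN1.subset h1))).2
      rw [h2] at this
      exact this.le
    exact h1.trans h2

end MWC
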